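/- Fix n ≥ 1, an integer k ≥ 1, a fixed family of nonnegative couplings J_X ≥ 0, h₁ ∈ [0,1], α ∈ [0,1], θ ∈ (1/2,1). Let τ₁,…,τₙ be i.i.d. Poisson(α n^{θ−1}). Assume that for every τ ∈ ℕⁿ and every h₀ ∈ (0,1) the Gibbs measure of the perturbed Hamiltonian satisfies both GKS inequalities: ⟨σ_T⟩ ≥ 0 and ⟨σ_T σ_S⟩ − ⟨σ_T⟩⟨σ_S⟩ ≥ 0 for all subsets T, S. Then for any interval [h̲, h̄] ⊂ (0,1), the integral over h₀ ∈ [h̲, h̄] of E_τ[(⟨Q_k⟩_τ − E_τ⟨Q_k⟩_τ)²] is at most α k h₁ / n^{1−θ}. -/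

import Mathlib

open MeasureTheory ProbabilityTheory Finset

noncomputable section

/-- The real value of a Boolean spin: `true ↦ 1`, `false ↦ -1`. -/
def spinVal (b : Bool) : ℝ := if b then 1 else -1

/-- The product of spins over a subset `X ⊆ {1,…,n}`. -/
def spinProd {n : ℕ} (X : Finset (Fin n)) (σ : Fin n → Bool) : ℝ :=
  ∏ i ∈ X, spinVal (σ i)

/-- The perturbed Hamiltonian
`H(σ) = -∑_X J_X σ_X - h₀ ∑ᵢ σᵢ - h₁ ∑ᵢ τᵢ σᵢ`. -/
def Ham (n : ℕ) (J : Finset (Fin n) → ℝ) (h₀ h₁ : ℝ) (τ : Fin n → ℕ)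
    (σ : Fin n → Bool) : ℝ :=
  -(∑ X : Finset (Fin n), J X * spinProd X σ)
    - h₀ * ∑ i, spinVal (σ i) - h₁ * ∑ i, (τ i : ℝ) * spinVal (σ i)

/-- The partition function `Z = ∑_σ e^{-H(σ)}`. -/
def Zp (n : ℕ) (H : (Fin n → Bool) → ℝ) : ℝ :=
  ∑ σ : Fin n → Bool, Real.exp (-(H σ))

/-- The Gibbs average `⟨f⟩ = Z⁻¹ ∑_σ f(σ) e^{-H(σ)}`. -/
def gibbs (n : ℕ) (H : (Fin n → Bool) → ℝ) (f : (Fin n → Bool) → ℝ) : ℝ :=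
  (∑ σ : Fin n → Bool, f σ * Real.exp (-(H σ))) / Zp n H

/-- The replicated Gibbs average of a function of `k` i.i.d. replicas. -/
def gibbsRep (n k : ℕ) (H : (Fin n → Bool) → ℝ)
    (f : (Fin k → Fin n → Bool) → ℝ) : ℝ :=
  (∑ σs : Fin k → Fin n → Bool, f σs * ∏ a, Real.exp (-(H (σs a)))) / (Zp n H) ^ k

/-- The multi-overlap `Q_k = n⁻¹ ∑ᵢ σᵢ⁽¹⁾⋯σᵢ⁽ᵏ⁾` of `k` replicas. -/
def QkRep (n k : ℕ) (σs : Fin k → Fin n → Bool) : ℝ :=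
  (n : ℝ)⁻¹ * ∑ i, ∏ a, spinVal (σs a i)

/-- The local magnetization `⟨σᵢ⟩`. -/
def magg (n : ℕ) (H : (Fin n → Bool) → ℝ) (i : Fin n) : ℝ :=
  gibbs n H fun σ => spinVal (σ i)

/-- The two-point function `⟨σᵢσⱼ⟩`. -/
def corrr (n : ℕ) (H : (Fin n → Bool) → ℝ) (i j : Fin n) : ℝ :=
  gibbs n H fun σ => spinVal (σ i) * spinVal (σ j)

/-- `⟨Q_k⟩ = n⁻¹ ∑ᵢ ⟨σᵢ⟩ᵏ`, the Gibbs average of the multi-overlap. -/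
def avgQ (n k : ℕ) (H : (Fin n → Bool) → ℝ) : ℝ :=
  gibbsRep n k H (QkRep n k)

/-- The product of `n` i.i.d. Poisson(`r`) distributions on `ℕⁿ`. -/
def ppi (n : ℕ) (r : ℝ) : Measure (Fin n → ℕ) :=
  Measure.pi fun _ : Fin n => poissonMeasure (Real.toNNReal r)

end
section probpart

theorem integrable_bdd {Ω : Type*} [MeasurableSpace Ω] [DiscreteMeasurableSpace Ω] [Countable Ω]
    (μ : Measure Ω) [IsFiniteMeasure μ] (f : Ω → ℝ) (C : ℝ) (h : ∀ x, |f x| ≤ C) :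
    Integrable f μ :=
  Integrable.of_bound (Measurable.of_discrete).aestronglyMeasurable C
    (Filter.Eventually.of_forall fun x => by simpa using h x)

theorem poisson_weight_succ (r : NNReal) (m : ℕ) :
    Real.exp (-(r:ℝ)) * (r:ℝ) ^ (m+1) / ((m+1).factorial : ℝ) * ((m+1 : ℕ) : ℝ)
      = r * (Real.exp (-(r:ℝ)) * (r:ℝ) ^ m / (m.factorial : ℝ)) := by
  rw [Nat.factorial_succ]
  have h1 : (m.factorial : ℝ) ≠ 0 := by positivity
  have h2 : ((m + 1 : ℕ) : ℝ) ≠ 0 := by positivity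
  push_cast at *
  field_simp
  ring

theorem poisson_integrable_id_mul (r : NNReal) (f : ℕ → ℝ) (h : ∀ x, |f x| ≤ 1) :
    Integrable (fun m : ℕ => (m : ℝ) * f m) (poissonMeasure r) := by
  rw [integrable_poissonMeasure_iff]
  rw [← summable_nat_add_iff 1]
  refine Summable.of_nonneg_of_le (fun m => by positivity) (fun m => ?_)
    ((hasSum_one_poissonMeasure r).summable.mul_left (r:ℝ))
  rw [norm_mul, ← mul_assoc, Real.norm_of_nonneg (by positivity), poisson_weight_succ]
  exact mul_le_of_le_one_right (by positivity) (by simpa using h (m+1))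

theorem poisson_stein (r : NNReal) (f : ℕ → ℝ) (h : ∀ x, |f x| ≤ 1) :
    ∫ m : ℕ, (m : ℝ) * f m ∂(poissonMeasure r) = r * ∫ m, f (m+1) ∂(poissonMeasure r) := by
  have h1 := hasSum_integral_poissonMeasure (poisson_integrable_id_mul r f h)
  have h2 := (hasSum_integral_poissonMeasure
    (integrable_bdd (poissonMeasure r) (fun m => f (m+1)) 1 (fun x => h _))).mul_left (r:ℝ)
  rw [← hasSum_nat_add_iff' 1] at h1
  simp only [Finset.sum_range_one, Nat.cast_zero, zero_mul, smul_zero, sub_zero] at h1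
  refine h1.unique ?_
  have e : (fun m : ℕ => (Real.exp (-(r:ℝ)) * (r:ℝ) ^ (m+1) / ((m+1).factorial : ℝ)) •
      (((m+1 : ℕ) : ℝ) * f (m+1)))
      = fun m : ℕ => (r:ℝ) * ((Real.exp (-(r:ℝ)) * (r:ℝ) ^ m / (m.factorial : ℝ)) • f (m+1)) := by
    ext m
    rw [smul_eq_mul, smul_eq_mul, ← mul_assoc, poisson_weight_succ, mul_assoc]
  rw [e]
  exact h2

theorem poisson_var_one (r : NNReal) (f : ℕ → ℝ) (hm : ∀ x, f x ≤ f (x+1))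
    (h0 : ∀ x, 0 ≤ f x) (h1 : ∀ x, f x ≤ 1) :
    ∫ x, f x ^ 2 ∂(poissonMeasure r) - (∫ x, f x ∂(poissonMeasure r)) ^ 2
      ≤ r * (∫ x, f (x+1) ∂(poissonMeasure r) - ∫ x, f x ∂(poissonMeasure r)) := by
  set μ := poissonMeasure r
  have hmono : Monotone f := monotone_nat_of_le_succ hm
  have habs : ∀ x, |f x| ≤ 1 := fun x => abs_le.2 ⟨by linarith [h0 x], h1 x⟩
  have If : Integrable f μ := integrable_bdd μ f 1 habs
  have If2 : Integrable (fun x => f x ^ 2) μ := integrable_bdd μ _ 1 (fun x => by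
    rw [abs_pow]; exact pow_le_one₀ (abs_nonneg _) (habs x))
  have INf := poisson_integrable_id_mul r f habs
  have IN : Integrable (fun m : ℕ => (m:ℝ)) μ := by
    simpa using poisson_integrable_id_mul r (fun _ => 1) (by simp)
  have EN : ∫ m : ℕ, (m:ℝ) ∂μ = r := by
    simpa [μ] using poisson_stein r (fun _ => 1) (by simp)
  have ENf := poisson_stein r f habs
  set c := ∫ x, f x ∂μ with hc
  have gmono : Monotone (fun m : ℕ => (m:ℝ) - f m) := monotone_nat_of_le_succ fun x => by
    push_cast; linarith [h0 x, h1 (x+1)]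
  have hex : ∃ x, c ≤ f x := exists_integral_le If
  classical
  set m := Nat.find hex with hmdef
  have key : 0 ≤ ∫ x : ℕ, (f x - c) * (((x:ℝ) - f x) - ((m:ℝ) - f m)) ∂μ := by
    refine integral_nonneg fun x => ?_
    simp only [Pi.zero_apply]
    rcases le_or_gt m x with hx | hx
    · exact mul_nonneg (sub_nonneg.2 ((Nat.find_spec hex).trans (hmono hx)))
        (sub_nonneg.2 (gmono hx))
    · have : f x < c := not_le.1 (Nat.find_min hex hx)
      exact mul_nonneg_of_nonpos_of_nonpos (by linarith) (sub_nonpos.2 (gmono hx.le))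
  have e : ∫ x : ℕ, (f x - c) * (((x:ℝ) - f x) - ((m:ℝ) - f m)) ∂μ
      = ∫ x : ℕ, ((x:ℝ) * f x - f x ^ 2 - c * x + (c - ((m:ℝ) - f m)) * f x
        + c * ((m:ℝ) - f m)) ∂μ := by
    congr 1; ext x; ring
  rw [e, integral_add, integral_add, integral_sub, integral_sub, integral_const_mul,
    integral_const_mul, integral_const, EN, ENf, ← hc] at key
  · simp only [probReal_univ, smul_eq_mul] at key
    linarith
  all_goals first | assumption | skip
  · exact INf.sub If2
  · exact IN.const_mul c
  · exact (INf.sub If2).sub (IN.const_mul c)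
  · exact If.const_mul _
  · exact ((INf.sub If2).sub (IN.const_mul c)).add (If.const_mul _)
  · exact integrable_const _

theorem ppi_integral_succ (n : ℕ) (r : ℝ) (f : (Fin (n+1) → ℕ) → ℝ) (C : ℝ)
    (hf : ∀ t, |f t| ≤ C) :
    ∫ t, f t ∂(ppi (n+1) r)
      = ∫ x, ∫ y, f (Fin.cons x y) ∂(ppi n r) ∂(poissonMeasure r.toNNReal) := by
  unfold ppi
  rw [← ((measurePreserving_piFinSuccAbove
    (fun _ : Fin (n+1) => poissonMeasure r.toNNReal) 0).symm).integral_comp']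
  rw [integral_prod]
  · simp only [MeasurableEquiv.piFinSuccAbove_symm_apply, Fin.insertNthEquiv, Equiv.coe_fn_mk,
      Fin.insertNth_zero']
  · exact integrable_bdd _ _ C (fun x => hf _)

instance ppi_prob (n : ℕ) (r : ℝ) : IsProbabilityMeasure (ppi n r) := by
  unfold ppi; infer_instance

theorem ppi_var (r : ℝ) (n : ℕ) (f : (Fin n → ℕ) → ℝ)
    (hm : ∀ t i, f t ≤ f (Function.update t i (t i + 1)))
    (h0 : ∀ t, 0 ≤ f t) (h1 : ∀ t, f t ≤ 1) :
    ∫ t, f t ^ 2 ∂(ppi n r) - (∫ t, f t ∂(ppi n r)) ^ 2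
      ≤ r.toNNReal * ∫ t, ∑ i, (f (Function.update t i (t i + 1)) - f t) ∂(ppi n r) := by
  induction n with
  | zero =>
    have hs : ∀ t, f t = f 0 := fun t => by congr 1; exact Subsingleton.elim _ _
    simp [hs]
  | succ n ih =>
    have habs : ∀ x, |f x| ≤ 1 := fun x => abs_le.2 ⟨by linarith [h0 x], h1 x⟩
    have hsq : ∀ x, |f x ^ 2| ≤ 1 := fun x => by
      rw [abs_pow]; exact pow_le_one₀ (abs_nonneg _) (habs x)
    have hD : ∀ t i, |f (Function.update t i (t i + 1)) - f t| ≤ 1 := fun t i => by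
      rw [abs_le]; constructor <;> linarith [hm t i, h0 t, h1 (Function.update t i (t i + 1))]
    set μ := poissonMeasure r.toNNReal
    set ν := ppi n r
    set g : ℕ → ℝ := fun x => ∫ y, f (Fin.cons x y) ∂ν with hg
    have Iy : ∀ x, Integrable (fun y => f (Fin.cons x y)) ν := fun x =>
      integrable_bdd _ _ 1 fun y => habs _
    have g0 : ∀ x, 0 ≤ g x := fun x => integral_nonneg fun y => h0 _
    have g1 : ∀ x, g x ≤ 1 := fun x => by
      have := integral_mono (Iy x) (integrable_const 1) (fun y => h1 _)
      simpa using this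
    have gm : ∀ x, g x ≤ g (x+1) := fun x => integral_mono (Iy x) (Iy (x+1)) fun y => by
      have := hm (Fin.cons x y) 0
      rwa [Fin.update_cons_zero, Fin.cons_zero] at this
    have gabs : ∀ x, |g x| ≤ 1 := fun x => abs_le.2 ⟨by linarith [g0 x], g1 x⟩
    have Ig : Integrable g μ := integrable_bdd _ _ 1 gabs
    have Ig1 : Integrable (fun x => g (x+1)) μ := integrable_bdd _ _ 1 fun x => gabs _
    have Ig2 : Integrable (fun x => g x ^ 2) μ := integrable_bdd _ _ 1 (fun x => by
      rw [abs_pow]; exact pow_le_one₀ (abs_nonneg _) (gabs x))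
    have hone := poisson_var_one r.toNNReal g gm g0 g1
    -- the inner variance
    set S : ℕ → ℝ := fun x => ∫ y, ∑ i : Fin n,
      (f (Fin.cons x (Function.update y i (y i + 1))) - f (Fin.cons x y)) ∂ν with hS
    set q : ℕ → ℝ := fun x => ∫ y, f (Fin.cons x y) ^ 2 ∂ν with hq
    have hin : ∀ x, q x - g x ^ 2 ≤ r.toNNReal * S x := fun x => by
      refine ih (fun y => f (Fin.cons x y)) (fun y i => ?_) (fun _ => h0 _) (fun _ => h1 _)
      have := hm (Fin.cons x y) i.succ
      rwa [← Fin.cons_update, Fin.cons_succ] at this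
    have hDx : ∀ x (y : Fin n → ℕ) i,
        |f (Fin.cons x (Function.update y i (y i + 1))) - f (Fin.cons x y)| ≤ 1 := by
      intro x y i
      have := hD (Fin.cons x y) i.succ
      rwa [← Fin.cons_update, Fin.cons_succ] at this
    have hsum : ∀ x y, |∑ i : Fin n,
        (f (Fin.cons x (Function.update y i (y i + 1))) - f (Fin.cons x y))| ≤ n := fun x y => by
      refine (Finset.abs_sum_le_sum_abs _ _).trans ((Finset.sum_le_sum fun i _ => hDx x y i).trans ?_)
      simp
    have absint : ∀ (F : (Fin n → ℕ) → ℝ) (C : ℝ), (∀ y, |F y| ≤ C) → |∫ y, F y ∂ν| ≤ C := by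
      intro F C hF
      have := norm_integral_le_of_norm_le_const (μ := ν) (f := F) (C := C)
        (Filter.Eventually.of_forall hF)
      simpa using this
    have IS : Integrable S μ := integrable_bdd _ _ n fun x => absint _ _ (hsum x)
    have Iq : Integrable q μ := integrable_bdd _ _ 1 fun x => absint _ _ fun y => hsq _
    have hinI : ∫ x, q x ∂μ - ∫ x, g x ^ 2 ∂μ ≤ r.toNNReal * ∫ x, S x ∂μ := by
      rw [← integral_sub Iq Ig2, ← integral_const_mul]
      exact integral_mono (Iq.sub Ig2) (IS.const_mul _) hin
    rw [ppi_integral_succ n r (fun t => f t ^ 2) 1 hsq, ppi_integral_succ n r f 1 habs,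
      ppi_integral_succ n r _ (n+1) (fun t => by
        refine (Finset.abs_sum_le_sum_abs _ _).trans
          ((Finset.sum_le_sum fun i _ => hD t i).trans ?_)
        simp)]
    have hfin : ∫ x, ∫ y, ∑ i : Fin (n+1),
        (f (Function.update (Fin.cons x y : Fin (n+1) → ℕ) i ((Fin.cons x y : Fin (n+1) → ℕ) i + 1))
          - f (Fin.cons x y)) ∂ν ∂μ
        = (∫ x, g (x+1) ∂μ - ∫ x, g x ∂μ) + ∫ x, S x ∂μ := by
      have I2 : Integrable (fun x => g (x+1) - g x) μ := Ig1.sub Ig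
      rw [← integral_sub Ig1 Ig, ← integral_add I2 IS]
      congr 1; ext x
      simp only [hg, hS]
      have I3 : Integrable (fun y => f (Fin.cons (x+1) y) - f (Fin.cons x y)) ν :=
        (Iy _).sub (Iy _)
      rw [← integral_sub (Iy _) (Iy _), ← integral_add I3
        (integrable_bdd _ _ n (hsum x))]
      congr 1; ext y
      rw [Fin.sum_univ_succ, Fin.update_cons_zero, Fin.cons_zero]
      simp only [← Fin.cons_update, Fin.cons_succ]
    rw [hfin]
    change ∫ x, q x ∂μ - (∫ x, g x ∂μ) ^ 2 ≤ _
    linarith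

end probpart

section physpart

theorem spinVal_abs (b : Bool) : |spinVal b| = 1 := by cases b <;> simp [spinVal]

theorem Zp_pos (n : ℕ) (H : (Fin n → Bool) → ℝ) : 0 < Zp n H :=
  Finset.sum_pos (fun _ _ => Real.exp_pos _) Finset.univ_nonempty

theorem gibbs_abs_le (n : ℕ) (H f : (Fin n → Bool) → ℝ) (hf : ∀ σ, |f σ| ≤ 1) :
    |gibbs n H f| ≤ 1 := by
  unfold gibbs
  rw [abs_div, abs_of_pos (Zp_pos n H), div_le_one (Zp_pos n H)]
  refine (Finset.abs_sum_le_sum_abs _ _).trans (Finset.sum_le_sum fun σ _ => ?_)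
  rw [abs_mul, abs_of_pos (Real.exp_pos _)]
  exact mul_le_of_le_one_left (Real.exp_pos _).le (hf σ)

theorem magg_abs (n : ℕ) (H : (Fin n → Bool) → ℝ) (i : Fin n) : |magg n H i| ≤ 1 :=
  gibbs_abs_le n H _ fun _ => (spinVal_abs _).le

theorem corrr_abs (n : ℕ) (H : (Fin n → Bool) → ℝ) (i j : Fin n) : |corrr n H i j| ≤ 1 :=
  gibbs_abs_le n H _ fun _ => by rw [abs_mul, spinVal_abs, spinVal_abs, one_mul]

theorem avgQ_eq (n k : ℕ) (H : (Fin n → Bool) → ℝ) :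
    avgQ n k H = (n : ℝ)⁻¹ * ∑ i, magg n H i ^ k := by
  unfold avgQ gibbsRep QkRep magg gibbs
  simp_rw [div_pow, mul_assoc, Finset.sum_mul, ← Finset.prod_mul_distrib]
  rw [← Finset.mul_sum, Finset.sum_comm, mul_div_assoc, Finset.sum_div]
  congr 1
  refine Finset.sum_congr rfl fun i _ => ?_
  congr 1
  have := Finset.sum_pow' (Finset.univ : Finset (Fin n → Bool))
    (fun σ => spinVal (σ i) * Real.exp (-(H σ))) k
  rw [this]
  simp

theorem ham_update (n : ℕ) (J : Finset (Fin n) → ℝ) (h₀ h₁ : ℝ) (τ : Fin n → ℕ) (i : Fin n)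
    (σ : Fin n → Bool) :
    Ham n J h₀ h₁ (Function.update τ i (τ i + 1)) σ = Ham n J h₀ h₁ τ σ - h₁ * spinVal (σ i) := by
  unfold Ham
  have : ∑ j, ((Function.update τ i (τ i + 1) j : ℕ) : ℝ) * spinVal (σ j)
      = ∑ j, (τ j : ℝ) * spinVal (σ j) + spinVal (σ i) := by
    have h : ∀ j, ((Function.update τ i (τ i + 1) j : ℕ) : ℝ) * spinVal (σ j)
        = (τ j : ℝ) * spinVal (σ j) + if j = i then spinVal (σ i) else 0 := by
      intro j
      by_cases hj : j = i
      · subst hj; simp; ring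
      · simp [hj]
    simp_rw [h, Finset.sum_add_distrib]
    simp
  rw [this]; ring

theorem exp_spin (h : ℝ) (b : Bool) :
    Real.exp (h * spinVal b) = Real.cosh h + Real.sinh h * spinVal b := by
  cases b <;> simp [spinVal, Real.cosh_eq, Real.sinh_eq] <;> ring

theorem sinh_le_mul_cosh (h : ℝ) (hh : 0 ≤ h) : Real.sinh h ≤ h * Real.cosh h := by
  have hm : MonotoneOn (fun x => x * Real.cosh x - Real.sinh x) (Set.Ici 0) := by
    have hd : ∀ x : ℝ, HasDerivAt (fun x => x * Real.cosh x - Real.sinh x)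
        (x * Real.sinh x) x := fun x => by
      have := ((hasDerivAt_id x).mul (Real.hasDerivAt_cosh x)).sub (Real.hasDerivAt_sinh x)
      refine this.congr_deriv ?_
      simp
    refine monotoneOn_of_deriv_nonneg (convex_Ici 0) ?_ ?_ ?_
    · exact fun x _ => (hd x).continuousAt.continuousWithinAt
    · exact fun x _ => (hd x).differentiableAt.differentiableWithinAt
    · intro x hx
      rw [interior_Ici] at hx
      rw [(hd x).deriv]
      exact mul_nonneg (le_of_lt hx) (Real.sinh_nonneg_iff.2 (le_of_lt hx))
  have := hm (Set.mem_Ici.2 le_rfl) (Set.mem_Ici.2 hh) hh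
  simp at this
  linarith

theorem magg_update (n : ℕ) (J : Finset (Fin n) → ℝ) (h₀ h₁ : ℝ) (τ : Fin n → ℕ) (i j : Fin n) :
    magg n (Ham n J h₀ h₁ (Function.update τ i (τ i + 1))) j
      = (Real.cosh h₁ * magg n (Ham n J h₀ h₁ τ) j
          + Real.sinh h₁ * corrr n (Ham n J h₀ h₁ τ) i j)
        / (Real.cosh h₁ + Real.sinh h₁ * magg n (Ham n J h₀ h₁ τ) i) := by
  have hw : ∀ σ, Real.exp (-(Ham n J h₀ h₁ (Function.update τ i (τ i + 1)) σ))
      = Real.exp (-(Ham n J h₀ h₁ τ σ)) * (Real.cosh h₁ + Real.sinh h₁ * spinVal (σ i)) := by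
    intro σ
    rw [ham_update, ← exp_spin, ← Real.exp_add]; congr 1; ring
  have hZ := (Zp_pos n (Ham n J h₀ h₁ τ)).ne'
  set H := Ham n J h₀ h₁ τ with hH
  have e1 : ∑ σ : Fin n → Bool, spinVal (σ j) *
      (Real.exp (-(H σ)) * (Real.cosh h₁ + Real.sinh h₁ * spinVal (σ i)))
      = Zp n H * (Real.cosh h₁ * magg n H j + Real.sinh h₁ * corrr n H i j) := by
    unfold magg corrr gibbs
    rw [mul_add, mul_left_comm, mul_left_comm (Zp n H), mul_div_cancel₀ _ hZ,
      mul_div_cancel₀ _ hZ, Finset.mul_sum, Finset.mul_sum, ← Finset.sum_add_distrib]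
    exact Finset.sum_congr rfl fun σ _ => by ring
  have e2 : ∑ σ : Fin n → Bool,
      (Real.exp (-(H σ)) * (Real.cosh h₁ + Real.sinh h₁ * spinVal (σ i)))
      = Zp n H * (Real.cosh h₁ + Real.sinh h₁ * magg n H i) := by
    unfold magg gibbs
    rw [mul_add, mul_left_comm (Zp n H) (Real.sinh h₁), mul_div_cancel₀ _ hZ]
    unfold Zp
    rw [Finset.mul_sum, Finset.sum_mul, ← Finset.sum_add_distrib]
    exact Finset.sum_congr rfl fun σ _ => by ring
  rw [magg, gibbs]
  unfold Zp
  simp_rw [hw]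
  rw [e1, e2, mul_div_mul_left _ _ hZ]

theorem magg_diff (n : ℕ) (J : Finset (Fin n) → ℝ) (h₀ h₁ : ℝ) (hh : 0 ≤ h₁)
    (τ : Fin n → ℕ) (i j : Fin n) (hi : 0 ≤ magg n (Ham n J h₀ h₁ τ) i)
    (hc : 0 ≤ corrr n (Ham n J h₀ h₁ τ) i j
      - magg n (Ham n J h₀ h₁ τ) i * magg n (Ham n J h₀ h₁ τ) j) :
    0 ≤ magg n (Ham n J h₀ h₁ (Function.update τ i (τ i + 1))) j - magg n (Ham n J h₀ h₁ τ) j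
    ∧ magg n (Ham n J h₀ h₁ (Function.update τ i (τ i + 1))) j - magg n (Ham n J h₀ h₁ τ) j
      ≤ h₁ * (corrr n (Ham n J h₀ h₁ τ) i j
      - magg n (Ham n J h₀ h₁ τ) i * magg n (Ham n J h₀ h₁ τ) j) := by
  rw [magg_update]
  set a := magg n (Ham n J h₀ h₁ τ) i
  set b := magg n (Ham n J h₀ h₁ τ) j
  set c := corrr n (Ham n J h₀ h₁ τ) i j
  have hC := Real.cosh_pos h₁
  have hS : 0 ≤ Real.sinh h₁ := Real.sinh_nonneg_iff.2 hh
  have hSC := sinh_le_mul_cosh h₁ hh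
  have hd : 0 < Real.cosh h₁ + Real.sinh h₁ * a := by positivity
  have e : (Real.cosh h₁ * b + Real.sinh h₁ * c) / (Real.cosh h₁ + Real.sinh h₁ * a) - b
      = Real.sinh h₁ * (c - a * b) / (Real.cosh h₁ + Real.sinh h₁ * a) := by
    field_simp; ring
  rw [e]
  refine ⟨by positivity, ?_⟩
  rw [div_le_iff₀ hd]
  have h4 : Real.sinh h₁ * (c - a*b) ≤ h₁ * Real.cosh h₁ * (c - a*b) :=
    mul_le_mul_of_nonneg_right hSC hc
  have h5 : 0 ≤ h₁ * (c - a*b) * (Real.sinh h₁ * a) := by positivity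
  linarith

theorem pow_diff (k : ℕ) (a b : ℝ) (ha : 0 ≤ a) (hab : a ≤ b) (hb : b ≤ 1) :
    b ^ k - a ^ k ≤ k * (b - a) := by
  induction k with
  | zero => simp
  | succ k ih =>
    have h1 : a ^ k ≤ 1 := pow_le_one₀ ha (hab.trans hb)
    have h3 : a ^ k ≤ b ^ k := pow_le_pow_left₀ ha hab k
    push_cast
    have e : b^(k+1) - a^(k+1) = b * (b^k - a^k) + a^k * (b - a) := by ring
    have h4 : b * (b^k - a^k) ≤ b^k - a^k :=
      mul_le_of_le_one_left (by linarith) hb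
    have h5 : a^k * (b-a) ≤ b - a := mul_le_of_le_one_left (by linarith) h1
    linarith

/-- the susceptibility -/
noncomputable def suscept (n : ℕ) (H : (Fin n → Bool) → ℝ) : ℝ :=
  (n : ℝ)⁻¹ * ∑ j, ∑ i, (corrr n H i j - magg n H i * magg n H j)

theorem magg_hasDeriv (n : ℕ) (J : Finset (Fin n) → ℝ) (h₀ h₁ : ℝ) (τ : Fin n → ℕ) (j : Fin n) :
    HasDerivAt (fun h => magg n (Ham n J h h₁ τ) j)
      (∑ i, (corrr n (Ham n J h₀ h₁ τ) i j
        - magg n (Ham n J h₀ h₁ τ) i * magg n (Ham n J h₀ h₁ τ) j)) h₀ := by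
  have hw : ∀ σ : Fin n → Bool, HasDerivAt (fun h => Real.exp (-(Ham n J h h₁ τ σ)))
      (Real.exp (-(Ham n J h₀ h₁ τ σ)) * ∑ i, spinVal (σ i)) h₀ := by
    intro σ
    have h1 : HasDerivAt (fun h => -(Ham n J h h₁ τ σ)) (∑ i, spinVal (σ i)) h₀ := by
      have h2 := ((hasDerivAt_id h₀).mul_const (∑ i, spinVal (σ i))).add_const
        ((∑ X : Finset (Fin n), J X * spinProd X σ) + h₁ * ∑ i, (τ i : ℝ) * spinVal (σ i))
      rw [one_mul] at h2
      refine h2.congr_of_eventuallyEq (Filter.Eventually.of_forall fun h => ?_)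
      simp only [Ham, id]; ring
    exact h1.exp
  have hN := HasDerivAt.fun_sum (u := (Finset.univ : Finset (Fin n → Bool)))
    (fun σ _ => (hw σ).const_mul (spinVal (σ j)))
  have hZ := HasDerivAt.fun_sum (u := (Finset.univ : Finset (Fin n → Bool))) (fun σ _ => hw σ)
  have hZ0 := (Zp_pos n (Ham n J h₀ h₁ τ)).ne'
  have := hN.fun_div hZ hZ0
  refine this.congr_deriv ?_
  set H := Ham n J h₀ h₁ τ with hH
  have e1 : ∑ σ : Fin n → Bool, spinVal (σ j) * (Real.exp (-(H σ)) * ∑ i, spinVal (σ i))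
      = Zp n H * ∑ i, corrr n H i j := by
    unfold corrr gibbs
    rw [← Finset.sum_div, mul_div_cancel₀ _ hZ0, Finset.sum_comm]
    refine Finset.sum_congr rfl fun σ _ => ?_
    rw [← Finset.sum_mul, ← Finset.sum_mul]; ring
  have e2 : ∑ σ : Fin n → Bool, (Real.exp (-(H σ)) * ∑ i, spinVal (σ i))
      = Zp n H * ∑ i, magg n H i := by
    unfold magg gibbs
    rw [← Finset.sum_div, mul_div_cancel₀ _ hZ0, Finset.sum_comm]
    refine Finset.sum_congr rfl fun σ _ => ?_
    rw [← Finset.sum_mul]; ring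
  have e3 : ∑ σ : Fin n → Bool, spinVal (σ j) * Real.exp (-(H σ)) = Zp n H * magg n H j := by
    unfold magg gibbs
    rw [mul_div_cancel₀ _ hZ0]
  rw [e1, e2, e3, Finset.sum_sub_distrib, ← Finset.sum_mul]
  change (Zp n H * _ * Zp n H - _) / (Zp n H) ^ 2 = _
  field_simp

theorem suscept_abs (n : ℕ) (H : (Fin n → Bool) → ℝ) : |suscept n H| ≤ (n:ℝ)⁻¹ * (n * (n * 2)) := by
  unfold suscept
  rw [abs_mul, abs_of_nonneg (by positivity : (0:ℝ) ≤ (n:ℝ)⁻¹)]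
  gcongr
  have : ∀ j i, |corrr n H i j - magg n H i * magg n H j| ≤ 2 := fun j i => by
    have h1 := corrr_abs n H i j
    have h2 : |magg n H i * magg n H j| ≤ 1 := by
      rw [abs_mul]; exact mul_le_one₀ (magg_abs _ _ _) (abs_nonneg _) (magg_abs _ _ _)
    rw [abs_le] at *
    constructor <;> linarith
  refine (Finset.abs_sum_le_sum_abs _ _).trans ?_
  have h3 : ∀ j ∈ (Finset.univ : Finset (Fin n)),
      |∑ i, (corrr n H i j - magg n H i * magg n H j)| ≤ n * 2 := fun j _ => by
    refine (Finset.abs_sum_le_sum_abs _ _).trans ((Finset.sum_le_sum fun i _ => this j i).trans ?_)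
    simp
  refine (Finset.sum_le_sum h3).trans ?_
  simp

end physpart

/-- Lemma 3.4, concentration of overlaps w.r.t. the Poisson
perturbation: for a fully ferromagnetic Hamiltonian (both GKS inequalities hold) with
fixed nonnegative couplings, and i.i.d. `τᵢ ~ Poisson(α n^{θ-1})`,
`∫_{h̲}^{h̄} E_τ[(⟨Q_k⟩_τ - E_τ⟨Q_k⟩_τ)²] dh₀ ≤ α k h₁ / n^{1-θ}`. -/
theorem poisson_fluctuations_overlap
    (n k : ℕ) (hn : 1 ≤ n) (hk : 1 ≤ k)
    (J : Finset (Fin n) → ℝ) (hJ : ∀ X, 0 ≤ J X)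
    (h₁ α θ : ℝ) (hh₁ : h₁ ∈ Set.Icc (0 : ℝ) 1) (hα : α ∈ Set.Icc (0 : ℝ) 1)
    (hθ : θ ∈ Set.Ioo (1/2 : ℝ) 1)
    (hGKS : ∀ (τ : Fin n → ℕ), ∀ h₀ ∈ Set.Ioo (0 : ℝ) 1, ∀ T S : Finset (Fin n),
      0 ≤ gibbs n (Ham n J h₀ h₁ τ) (spinProd T)
      ∧ gibbs n (Ham n J h₀ h₁ τ) (spinProd T)
          * gibbs n (Ham n J h₀ h₁ τ) (spinProd S)
        ≤ gibbs n (Ham n J h₀ h₁ τ) (fun σ => spinProd T σ * spinProd S σ))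
    (hlow hhigh : ℝ) (h1 : 0 < hlow) (h2 : hlow ≤ hhigh) (h3 : hhigh < 1) :
    ∫ h₀ in hlow..hhigh,
        ∫ t, (avgQ n k (Ham n J h₀ h₁ t)
            - ∫ t', avgQ n k (Ham n J h₀ h₁ t')
                ∂(ppi n (α * (n : ℝ) ^ (θ - 1)))) ^ 2
          ∂(ppi n (α * (n : ℝ) ^ (θ - 1)))
      ≤ α * k * h₁ / (n : ℝ) ^ (1 - θ) := by
  classical
  set r : ℝ := α * (n : ℝ) ^ (θ - 1) with hr
  have hnpos : (0:ℝ) < n := by exact_mod_cast hn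
  have hr0 : 0 ≤ r := mul_nonneg hα.1 (Real.rpow_nonneg hnpos.le _)
  have hrr : ((Real.toNNReal r : NNReal) : ℝ) = r := Real.coe_toNNReal r hr0
  have hrhs : α * k * h₁ / (n : ℝ) ^ (1 - θ) = r * (k * h₁) := by
    rw [hr, show θ - 1 = -(1 - θ) by ring, Real.rpow_neg hnpos.le]
    field_simp
  rw [hrhs]
  set φ : ℝ → ℝ := fun h₀ => ∫ t, (avgQ n k (Ham n J h₀ h₁ t)
            - ∫ t', avgQ n k (Ham n J h₀ h₁ t') ∂(ppi n r)) ^ 2 ∂(ppi n r) with hφ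
  change ∫ h₀ in hlow..hhigh, φ h₀ ≤ _
  by_cases hint : IntegrableOn φ (Set.Icc hlow hhigh)
  swap
  · have : ¬ IntervalIntegrable φ volume hlow hhigh := by
      rwa [intervalIntegrable_iff_integrableOn_Icc_of_le h2]
    rw [intervalIntegral.integral_undef this]
    exact mul_nonneg hr0 (mul_nonneg (Nat.cast_nonneg _) hh₁.1)
  -- mean magnetization
  set M : ℝ → (Fin n → ℕ) → ℝ := fun h t => (n:ℝ)⁻¹ * ∑ j, magg n (Ham n J h h₁ t) j with hM
  have Mabs : ∀ h t, |M h t| ≤ 1 := fun h t => by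
    simp only [hM]
    rw [abs_mul, abs_of_pos (inv_pos.2 hnpos), inv_mul_le_iff₀ hnpos, mul_one]
    refine (Finset.abs_sum_le_sum_abs _ _).trans
      ((Finset.sum_le_sum fun j _ => magg_abs _ _ j).trans ?_)
    simp
  have hMd : ∀ h t, HasDerivAt (fun h => M h t) (suscept n (Ham n J h h₁ t)) h := fun h t =>
    (HasDerivAt.fun_sum fun j _ => magg_hasDeriv n J h h₁ t j).const_mul _
  have hG : ∀ h, HasDerivAt (fun h => ∫ t, M h t ∂(ppi n r))
      (∫ t, suscept n (Ham n J h h₁ t) ∂(ppi n r)) h := fun h =>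
    (hasDerivAt_integral_of_dominated_loc_of_deriv_le (s := Set.univ)
      (F := M) (F' := fun h t => suscept n (Ham n J h h₁ t))
      (bound := fun _ => (n:ℝ)⁻¹ * (n * (n * 2))) Filter.univ_mem
      (Filter.Eventually.of_forall fun _ => (Measurable.of_discrete).aestronglyMeasurable)
      (integrable_bdd _ _ 1 (Mabs h)) (Measurable.of_discrete).aestronglyMeasurable
      (Filter.Eventually.of_forall fun t h _ => suscept_abs _ _)
      (integrable_const _)
      (Filter.Eventually.of_forall fun t h _ => hMd h t)).2
  have mnn : ∀ t, ∀ h ∈ Set.Ioo (0:ℝ) 1, ∀ i, 0 ≤ magg n (Ham n J h h₁ t) i := by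
    intro t h hh i
    have := (hGKS t h hh {i} {i}).1
    unfold spinProd at this
    simp only [Finset.prod_singleton] at this
    exact this
  have cnn : ∀ t, ∀ h ∈ Set.Ioo (0:ℝ) 1, ∀ i j, 0 ≤ corrr n (Ham n J h h₁ t) i j
      - magg n (Ham n J h h₁ t) i * magg n (Ham n J h h₁ t) j := by
    intro t h hh i j
    have := (hGKS t h hh {i} {j}).2
    unfold spinProd at this
    simp only [Finset.prod_singleton] at this
    exact sub_nonneg.2 this
  have hbound : ∀ h ∈ Set.Ioo hlow hhigh,
      φ h ≤ r * (k * h₁) * ∫ t, suscept n (Ham n J h h₁ t) ∂(ppi n r) := by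
    intro h hh'
    have hh : h ∈ Set.Ioo (0:ℝ) 1 := ⟨h1.trans hh'.1, hh'.2.trans h3⟩
    set f : (Fin n → ℕ) → ℝ := fun t => avgQ n k (Ham n J h h₁ t) with hf
    have f0 : ∀ t, 0 ≤ f t := fun t => by
      simp only [hf, avgQ_eq]
      exact mul_nonneg (inv_pos.2 hnpos).le
        (Finset.sum_nonneg fun i _ => pow_nonneg (mnn t h hh i) k)
    have m1 : ∀ t i, magg n (Ham n J h h₁ t) i ≤ 1 := fun t i => (abs_le.1 (magg_abs _ _ _)).2
    have f1 : ∀ t, f t ≤ 1 := fun t => by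
      simp only [hf, avgQ_eq]
      rw [inv_mul_le_iff₀ hnpos, mul_one]
      refine (Finset.sum_le_sum fun j _ => pow_le_one₀ (mnn t h hh j) (m1 t j)).trans ?_
      simp
    have hd := fun t i j => magg_diff n J h h₁ hh₁.1 t i j (mnn t h hh i) (cnn t h hh i j)
    have fm : ∀ t i, f t ≤ f (Function.update t i (t i + 1)) := fun t i => by
      simp only [hf, avgQ_eq]
      refine mul_le_mul_of_nonneg_left (Finset.sum_le_sum fun j _ => ?_) (inv_pos.2 hnpos).le
      exact pow_le_pow_left₀ (mnn t h hh j) (sub_nonneg.1 (hd t i j).1) k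
    have hv := ppi_var r n f fm f0 f1
    rw [hrr] at hv
    have fabs : ∀ x, |f x| ≤ 1 := fun x => abs_le.2 ⟨by linarith [f0 x], f1 x⟩
    have If : Integrable f (ppi n r) := integrable_bdd _ f 1 fabs
    have If2 : Integrable (fun x => f x ^ 2) (ppi n r) := integrable_bdd _ _ 1 (fun x => by
      rw [abs_pow]; exact pow_le_one₀ (abs_nonneg _) (fabs x))
    have hphi : φ h = ∫ t, f t ^ 2 ∂(ppi n r) - (∫ t, f t ∂(ppi n r)) ^ 2 := by
      change ∫ t, (f t - ∫ t', f t' ∂(ppi n r)) ^ 2 ∂(ppi n r) = _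
      set c := ∫ t', f t' ∂(ppi n r) with hc
      have e : ∀ t, (f t - c) ^ 2 = (f t ^ 2 - 2 * c * f t) + c ^ 2 := fun t => by ring
      have I1 : Integrable (fun t => f t ^ 2 - 2 * c * f t) (ppi n r) := If2.sub (If.const_mul _)
      simp_rw [e]
      rw [integral_add I1 (integrable_const _), integral_sub If2 (If.const_mul _),
        integral_const_mul, ← hc, integral_const]
      simp only [probReal_univ, smul_eq_mul]
      ring
    rw [hphi]
    refine hv.trans ?_
    rw [mul_assoc r]
    refine mul_le_mul_of_nonneg_left ?_ hr0
    rw [← integral_const_mul]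
    have Is : Integrable (fun t => suscept n (Ham n J h h₁ t)) (ppi n r) :=
      integrable_bdd _ _ _ fun t => suscept_abs _ _
    refine integral_mono (integrable_finset_sum _ fun i _ =>
      (integrable_bdd _ _ 1 fun x => fabs _).sub If) (Is.const_mul _) fun t => ?_
    have step : ∀ i, f (Function.update t i (t i + 1)) - f t
        ≤ (n:ℝ)⁻¹ * ∑ j, k * (h₁ * (corrr n (Ham n J h h₁ t) i j
          - magg n (Ham n J h h₁ t) i * magg n (Ham n J h h₁ t) j)) := fun i => by
      simp only [hf, avgQ_eq]
      rw [← mul_sub, ← Finset.sum_sub_distrib]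
      refine mul_le_mul_of_nonneg_left (Finset.sum_le_sum fun j _ => ?_) (inv_pos.2 hnpos).le
      refine (pow_diff k _ _ (mnn t h hh j) (sub_nonneg.1 (hd t i j).1) (m1 _ _)).trans ?_
      exact mul_le_mul_of_nonneg_left (hd t i j).2 (Nat.cast_nonneg _)
    refine (Finset.sum_le_sum fun i _ => step i).trans (le_of_eq ?_)
    unfold suscept
    rw [← Finset.mul_sum, Finset.sum_comm]
    simp_rw [← Finset.mul_sum]
    ring
  have hGc : ∀ h, HasDerivAt (fun h => r * (k * h₁) * ∫ t, M h t ∂(ppi n r))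
      (r * (k * h₁) * ∫ t, suscept n (Ham n J h h₁ t) ∂(ppi n r)) h := fun h =>
    (hG h).const_mul _
  have hmain := intervalIntegral.integral_le_sub_of_hasDeriv_right_of_le h2
    (fun x _ => (hGc x).continuousAt.continuousWithinAt)
    (fun x _ => (hGc x).hasDerivWithinAt) hint hbound
  refine hmain.trans ?_
  rw [← mul_sub]
  refine mul_le_of_le_one_right (mul_nonneg hr0 (mul_nonneg (Nat.cast_nonneg _) hh₁.1)) ?_
  have u1 : ∫ t, M hhigh t ∂(ppi n r) ≤ 1 := by
    have := integral_mono (μ := ppi n r) (integrable_bdd _ _ 1 (Mabs hhigh)) (integrable_const 1)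
      (fun t => (abs_le.1 (Mabs hhigh t)).2)
    simpa using this
  have u2 : 0 ≤ ∫ t, M hlow t ∂(ppi n r) := integral_nonneg fun t =>
    mul_nonneg (inv_pos.2 hnpos).le
      (Finset.sum_nonneg fun j _ => mnn t hlow ⟨h1, h2.trans_lt h3⟩ j)
  linarith
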